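/- (Guaranteed monotonic joint policy optimization) Let a finite discounted MDP with initial distribution d₀ be given, with joint action type 𝒜 = Π_{i=1}^N 𝒜_i for finite nonempty agent action types 𝒜_1, …, 𝒜_N, and let K ≥ 1. Let (w_k, (π^i_k)) and (w_{k+1}, (π^i_{k+1})) be two conductor-based product policies in which all conditional probability mass functions are strictly positive, with induced joint policies μ_k(s,a) = ∑_j w_k(s,j) ∏_i π^i_k(j,s,a_i) and μ_{k+1}(s,a) = ∑_j w_{k+1}(s,j) ∏_i π^i_{k+1}(j,s,a_i). Set C := 4 γ (max_{s,a} |A_{μ_k}(s,a)|) / (1 − γ)². Assume: (H1) ∑_s ρ_{μ_k}(s) · ∑_j w_{k+1}(s,j) · A_{μ_k}(j | s) − C · (∑_s ρ_{μ_k}(s)) · max_{s'} D_KL(w_k(s',·), w_{k+1}(s',·)) ≥ 0; and (H2) for every agent l ∈ {1, …, N}: ∑_s ρ_{μ_k}(s) · ∑_j [ w_{k+1}(s,j) · L^{l}_k(π^{1:l−1}_{k+1}, π^{l}_{k+1} | s, j) − C · max_{s'} ( w_k(s',j) · D_KL(π^{l}_k(j,s',·), π^{l}_{k+1}(j,s',·))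 ) ] ≥ 0. Then J(μ_{k+1}) ≥ J(μ_k). -/

import Mathlib

open Finset

noncomputable section

variable {S : Type*}

/-- The Kullback–Leibler divergence between two positive probability mass
functions on a finite type. -/
def KL {X : Type*} [Fintype X] (p q : X → ℝ) : ℝ :=
  ∑ x, p x * Real.log (p x / q x)

/-- The state-distribution sequence generated by policy `μ` from the initial
distribution `d₀` in the MDP with transition function `P`. -/
def dseq {𝒜 : Type*} [Fintype S] [Fintype 𝒜] (P : S → 𝒜 → S → ℝ)
    (μ : S → 𝒜 → ℝ) (d₀ : S → ℝ) : ℕ → S → ℝ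
  | 0 => d₀
  | t + 1 => fun s' => ∑ s, ∑ a, dseq P μ d₀ t s * μ s a * P s a s'

/-- The expected discounted return of policy `μ` from initial distribution `d₀`,
in the MDP with transitions `P`, rewards `r` and discount `γ`. -/
def Jret {𝒜 : Type*} [Fintype S] [Fintype 𝒜] (P : S → 𝒜 → S → ℝ)
    (r : S → 𝒜 → ℝ) (γ : ℝ) (μ : S → 𝒜 → ℝ) (d₀ : S → ℝ) : ℝ :=
  ∑' t : ℕ, γ ^ t * ∑ s, ∑ a, dseq P μ d₀ t s * μ s a * r s a

/-- The value function of `μ`: the return from the Dirac mass at `s`. -/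
def Vfun {𝒜 : Type*} [Fintype S] [Fintype 𝒜] [DecidableEq S]
    (P : S → 𝒜 → S → ℝ) (r : S → 𝒜 → ℝ) (γ : ℝ) (μ : S → 𝒜 → ℝ) (s : S) : ℝ :=
  Jret P r γ μ (fun s' => if s' = s then 1 else 0)

/-- The state-action value function of `μ`. -/
def Qfun {𝒜 : Type*} [Fintype S] [Fintype 𝒜] [DecidableEq S]
    (P : S → 𝒜 → S → ℝ) (r : S → 𝒜 → ℝ) (γ : ℝ) (μ : S → 𝒜 → ℝ)
    (s : S) (a : 𝒜) : ℝ :=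
  r s a + γ * ∑ s', P s a s' * Vfun P r γ μ s'

/-- The advantage function of `μ`. -/
def Adv {𝒜 : Type*} [Fintype S] [Fintype 𝒜] [DecidableEq S]
    (P : S → 𝒜 → S → ℝ) (r : S → 𝒜 → ℝ) (γ : ℝ) (μ : S → 𝒜 → ℝ)
    (s : S) (a : 𝒜) : ℝ :=
  Qfun P r γ μ s a - Vfun P r γ μ s

/-- The (unnormalized) discounted state-visitation measure `ρ_μ`. -/
def rho {𝒜 : Type*} [Fintype S] [Fintype 𝒜] (P : S → 𝒜 → S → ℝ)
    (μ : S → 𝒜 → ℝ) (d₀ : S → ℝ) (γ : ℝ) (s : S) : ℝ :=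
  ∑' t : ℕ, γ ^ t * dseq P μ d₀ t s

/-- The partial Q-function `Q^{1:m}`: the expectation of `Q` over the
coordinates with index `≥ m` (the "completions"), drawn independently from the
policies `π`, with the coordinates of index `< m` fixed to those of `a`. -/
def Qpart {N : ℕ} {𝒜 : Fin N → Type*} [∀ l, Fintype (𝒜 l)]
    (π : ∀ l, 𝒜 l → ℝ) (Q : (∀ l, 𝒜 l) → ℝ) (m : ℕ) (a : ∀ l, 𝒜 l) : ℝ :=
  ∑ b : ∀ l : {l : Fin N // m ≤ (l : ℕ)}, 𝒜 l.1,
    (∏ l : {l : Fin N // m ≤ (l : ℕ)}, π l.1 (b l)) *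
      Q (fun l => if h : m ≤ (l : ℕ) then b ⟨l, h⟩ else a l)

section Divergence

variable {X : Type*} [Fintype X]

/-- The squared `ℓ¹` distance is at most four times the Kullback–Leibler divergence. -/
theorem sq_sum_abs_sub_le_four_mul_KL {p q : X → ℝ} (hp : ∀ x, 0 < p x) (hq : ∀ x, 0 < q x)
    (hp1 : ∑ x, p x = 1) (hq1 : ∑ x, q x = 1) :
    (∑ x, |q x - p x|) ^ 2 ≤ 4 * KL p q := by
  have hellinger : ∑ x, (√(q x) - √(p x)) ^ 2 ≤ KL p q := by
    have key : ∀ x, 2 * p x - 2 * (√(q x) * √(p x)) ≤ p x * Real.log (p x / q x) := by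
      intro x
      have ha := Real.sqrt_pos.2 (hp x)
      have hb := Real.sqrt_pos.2 (hq x)
      have hlog : Real.log (p x / q x) = 2 * Real.log (√(p x) / √(q x)) := by
        rw [← Real.sqrt_div (hp x).le, Real.log_sqrt (div_pos (hp x) (hq x)).le]
        ring
      have h := Real.one_sub_inv_le_log_of_pos (div_pos ha hb)
      have hpx := Real.mul_self_sqrt (hp x).le
      have h2 : p x * (√(p x) / √(q x))⁻¹ = √(q x) * √(p x) := by
        rw [inv_div]
        field_simp
        rw [sq, hpx]
      rw [hlog]
      nlinarith [mul_le_mul_of_nonneg_left h (hp x).le]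
    have expand : ∀ x, (√(q x) - √(p x)) ^ 2
        = (2 * p x - 2 * (√(q x) * √(p x))) + (q x - p x) := by
      intro x
      nlinarith [Real.mul_self_sqrt (hp x).le, Real.mul_self_sqrt (hq x).le]
    calc ∑ x, (√(q x) - √(p x)) ^ 2
        = ∑ x, (2 * p x - 2 * (√(q x) * √(p x))) := by
          simp only [expand]
          rw [Finset.sum_add_distrib, Finset.sum_sub_distrib q p, hp1, hq1]
          ring
      _ ≤ KL p q := Finset.sum_le_sum fun x _ => key x
  have hplus : ∑ x, (√(q x) + √(p x)) ^ 2 ≤ 4 := by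
    calc ∑ x, (√(q x) + √(p x)) ^ 2 ≤ ∑ x, (2 * q x + 2 * p x) :=
          Finset.sum_le_sum fun x _ => by
            nlinarith [Real.mul_self_sqrt (hp x).le, Real.mul_self_sqrt (hq x).le,
              sq_nonneg (√(q x) - √(p x))]
      _ = 4 := by
          rw [Finset.sum_add_distrib, ← Finset.mul_sum, ← Finset.mul_sum, hp1, hq1]
          norm_num
  have hfactor : ∀ x, |q x - p x| = |√(q x) - √(p x)| * (√(q x) + √(p x)) := by
    intro x
    rw [← abs_of_nonneg (add_nonneg (Real.sqrt_nonneg (q x)) (Real.sqrt_nonneg (p x))),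
      ← abs_mul]
    congr 1
    nlinarith [Real.mul_self_sqrt (hp x).le, Real.mul_self_sqrt (hq x).le]
  calc (∑ x, |q x - p x|) ^ 2
      = (∑ x, |√(q x) - √(p x)| * (√(q x) + √(p x))) ^ 2 := by simp only [hfactor]
    _ ≤ (∑ x, |√(q x) - √(p x)| ^ 2) * ∑ x, (√(q x) + √(p x)) ^ 2 :=
        Finset.sum_mul_sq_le_sq_mul_sq _ _ _
    _ = (∑ x, (√(q x) - √(p x)) ^ 2) * ∑ x, (√(q x) + √(p x)) ^ 2 := by simp only [sq_abs]
    _ ≤ KL p q * 4 := by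
        have h0 : 0 ≤ ∑ x, (√(q x) - √(p x)) ^ 2 := Finset.sum_nonneg fun x _ => sq_nonneg _
        exact mul_le_mul hellinger hplus (Finset.sum_nonneg fun x _ => sq_nonneg _)
          (h0.trans hellinger)
    _ = 4 * KL p q := mul_comm _ _

/-- The log-sum inequality. -/
theorem sum_mul_log_div_sum_le [Nonempty X] {p q : X → ℝ} (hp : ∀ x, 0 < p x)
    (hq : ∀ x, 0 < q x) :
    (∑ x, p x) * Real.log ((∑ x, p x) / ∑ x, q x) ≤ ∑ x, p x * Real.log (p x / q x) := by
  set A := ∑ x, p x with hA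
  set B := ∑ x, q x with hB
  have hA0 : 0 < A := Finset.sum_pos (fun x _ => hp x) Finset.univ_nonempty
  have hB0 : 0 < B := Finset.sum_pos (fun x _ => hq x) Finset.univ_nonempty
  have key : ∀ x, p x * Real.log (A / B) + (p x - q x * (A / B)) ≤
      p x * Real.log (p x / q x) := by
    intro x
    have hpq := div_pos (hp x) (hq x)
    have hAB := div_pos hA0 hB0
    have h := Real.one_sub_inv_le_log_of_pos (div_pos hpq hAB)
    rw [Real.log_div hpq.ne' hAB.ne'] at h
    have h2 : p x * (p x / q x / (A / B))⁻¹ = q x * (A / B) := by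
      have := (hp x).ne'
      have := (hq x).ne'
      field_simp
    nlinarith [mul_le_mul_of_nonneg_left h (hp x).le]
  calc A * Real.log (A / B)
      = ∑ x, (p x * Real.log (A / B) + (p x - q x * (A / B))) := by
        rw [Finset.sum_add_distrib, Finset.sum_sub_distrib, ← Finset.sum_mul, ← Finset.sum_mul,
          ← hA, ← hB, mul_div_cancel₀ _ hB0.ne']
        ring
    _ ≤ _ := Finset.sum_le_sum fun x _ => key x

end Divergence

section ProductMeasure

variable {ι : Type*} [Fintype ι] [DecidableEq ι] {𝒜 : ι → Type*} [∀ i, Fintype (𝒜 i)]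

theorem sum_pi_prod_eq_one {p : ∀ i, 𝒜 i → ℝ} (hp : ∀ i, ∑ x, p i x = 1) :
    ∑ a : ∀ i, 𝒜 i, ∏ i, p i (a i) = 1 := by
  have h := Finset.prod_univ_sum (fun i => (Finset.univ : Finset (𝒜 i))) p
  rw [Fintype.piFinset_univ] at h
  rw [← h]
  simp [hp]

theorem sum_mixture_eq_one {κ : Type*} [Fintype κ] {v : κ → ℝ} {p : κ → ∀ i, 𝒜 i → ℝ}
    (hv : ∑ j, v j = 1) (hp : ∀ j i, ∑ x, p j i x = 1) :
    ∑ a : ∀ i, 𝒜 i, ∑ j, v j * ∏ i, p j i (a i) = 1 := by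
  rw [Finset.sum_comm]
  simp only [← Finset.mul_sum, sum_pi_prod_eq_one (hp _), mul_one, hv]

/-- The expectation, under a product measure, of a function of a single coordinate. -/
theorem sum_pi_prod_mul_apply {p : ∀ i, 𝒜 i → ℝ} (hp : ∀ i, ∑ x, p i x = 1) (l : ι)
    (g : 𝒜 l → ℝ) :
    ∑ a : ∀ i, 𝒜 i, (∏ i, p i (a i)) * g (a l) = ∑ x, p l x * g x := by
  have h := Finset.prod_univ_sum (fun i => (Finset.univ : Finset (𝒜 i)))
    (Function.update p l fun x => p l x * g x)
  rw [Fintype.piFinset_univ] at h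
  have hl : ∀ i ∈ Finset.univ.erase l,
      ∑ x, Function.update p l (fun x => p l x * g x) i x = 1 := by
    intro i hi
    rw [Function.update_of_ne (Finset.ne_of_mem_erase hi), hp]
  rw [← Finset.mul_prod_erase _ _ (Finset.mem_univ l), Finset.prod_congr rfl hl] at h
  simp only [Function.update_self, Finset.prod_const_one, mul_one] at h
  rw [h]
  refine Finset.sum_congr rfl fun a _ => ?_
  rw [← Finset.mul_prod_erase _ _ (Finset.mem_univ l),
    ← Finset.mul_prod_erase _ (fun i => Function.update p l _ i (a i)) (Finset.mem_univ l)]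
  have hrest : ∏ i ∈ Finset.univ.erase l, Function.update p l (fun x => p l x * g x) i (a i)
      = ∏ i ∈ Finset.univ.erase l, p i (a i) :=
    Finset.prod_congr rfl fun i hi => by
      rw [Function.update_of_ne (Finset.ne_of_mem_erase hi)]
  rw [hrest, Function.update_self]
  ring

/-- The Kullback–Leibler divergence is additive over product measures. -/
theorem KL_pi_prod {p q : ∀ i, 𝒜 i → ℝ} (hp : ∀ i x, 0 < p i x) (hq : ∀ i x, 0 < q i x)
    (hp1 : ∀ i, ∑ x, p i x = 1) :
    KL (fun a : ∀ i, 𝒜 i => ∏ i, p i (a i)) (fun a => ∏ i, q i (a i))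
      = ∑ i, KL (p i) (q i) := by
  have hlog : ∀ a : ∀ i, 𝒜 i, Real.log ((∏ i, p i (a i)) / ∏ i, q i (a i))
      = ∑ i, Real.log (p i (a i) / q i (a i)) := by
    intro a
    rw [← Finset.prod_div_distrib,
      Real.log_prod fun i _ => (div_pos (hp i (a i)) (hq i (a i))).ne']
  simp only [KL, hlog, Finset.mul_sum]
  rw [Finset.sum_comm]
  exact Finset.sum_congr rfl fun i _ =>
    sum_pi_prod_mul_apply hp1 i fun x => Real.log (p i x / q i x)

/-- The divergence between two mixtures of product measures is at most the divergence between
the mixing weights plus the averaged divergences between the factors. -/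
theorem KL_mixture_le {κ : Type*} [Fintype κ] [Nonempty κ] {u v : κ → ℝ}
    {p q : κ → ∀ i, 𝒜 i → ℝ} (hu : ∀ j, 0 < u j) (hv : ∀ j, 0 < v j)
    (hp : ∀ j i x, 0 < p j i x) (hq : ∀ j i x, 0 < q j i x) (hp1 : ∀ j i, ∑ x, p j i x = 1) :
    KL (fun a : ∀ i, 𝒜 i => ∑ j, u j * ∏ i, p j i (a i))
        (fun a => ∑ j, v j * ∏ i, q j i (a i))
      ≤ KL u v + ∑ i, ∑ j, u j * KL (p j i) (q j i) := by
  have hpp : ∀ j (a : ∀ i, 𝒜 i), 0 < ∏ i, p j i (a i) :=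
    fun j a => Finset.prod_pos fun i _ => hp j i (a i)
  have hqq : ∀ j (a : ∀ i, 𝒜 i), 0 < ∏ i, q j i (a i) :=
    fun j a => Finset.prod_pos fun i _ => hq j i (a i)
  have hlog : ∀ j (a : ∀ i, 𝒜 i),
      Real.log ((u j * ∏ i, p j i (a i)) / (v j * ∏ i, q j i (a i)))
      = Real.log (u j / v j) + Real.log ((∏ i, p j i (a i)) / ∏ i, q j i (a i)) := by
    intro j a
    rw [mul_div_mul_comm, Real.log_mul (div_pos (hu j) (hv j)).ne'
      (div_pos (hpp j a) (hqq j a)).ne']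
  calc KL (fun a : ∀ i, 𝒜 i => ∑ j, u j * ∏ i, p j i (a i))
        (fun a => ∑ j, v j * ∏ i, q j i (a i))
      ≤ ∑ a : ∀ i, 𝒜 i, ∑ j, u j * (∏ i, p j i (a i)) *
          Real.log ((u j * ∏ i, p j i (a i)) / (v j * ∏ i, q j i (a i))) :=
        Finset.sum_le_sum fun a _ => sum_mul_log_div_sum_le
          (fun j => mul_pos (hu j) (hpp j a)) (fun j => mul_pos (hv j) (hqq j a))
    _ = ∑ j, (u j * Real.log (u j / v j) * ∑ a : ∀ i, 𝒜 i, ∏ i, p j i (a i)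
          + u j * KL (fun a : ∀ i, 𝒜 i => ∏ i, p j i (a i)) (fun a => ∏ i, q j i (a i))) := by
        rw [Finset.sum_comm]
        refine Finset.sum_congr rfl fun j _ => ?_
        rw [KL, Finset.mul_sum, Finset.mul_sum, ← Finset.sum_add_distrib]
        refine Finset.sum_congr rfl fun a _ => ?_
        rw [hlog]
        ring
    _ = KL u v + ∑ i, ∑ j, u j * KL (p j i) (q j i) := by
        simp only [sum_pi_prod_eq_one (hp1 _), KL_pi_prod (hp _) (hq _) (hp1 _), mul_one,
          Finset.mul_sum]
        rw [Finset.sum_add_distrib, Finset.sum_comm (f := fun i j => u j * KL (p j i) (q j i))]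
        rfl

end ProductMeasure

section PartialQ

variable {N : ℕ} {𝒜 : Fin N → Type*} [∀ i, Fintype (𝒜 i)]

/-- Averaging `Q^{1:m}` over the first `m` coordinates drawn from `p` gives the expectation of
`Q` when the first `m` coordinates follow `p` and the others follow `π`; the weights `p` of the
coordinates of index `≥ m` are irrelevant. -/
theorem sum_pi_prod_mul_Qpart (π p : ∀ i, 𝒜 i → ℝ) (hp : ∀ i, ∑ x, p i x = 1)
    (Q : (∀ i, 𝒜 i) → ℝ) (m : ℕ) :
    ∑ a : ∀ i, 𝒜 i, (∏ i, p i (a i)) * Qpart π Q m a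
      = ∑ a : ∀ i, 𝒜 i, (∏ i : Fin N, if (i : ℕ) < m then p i (a i) else π i (a i)) * Q a := by
  let e := Equiv.piEquivPiSubtypeProd (fun i : Fin N => m ≤ (i : ℕ)) 𝒜
  have hsplit : ∀ (f : ∀ i, 𝒜 i → ℝ) (b : ∀ i : {i : Fin N // m ≤ (i : ℕ)}, 𝒜 i)
      (c : ∀ i : {i : Fin N // ¬ m ≤ (i : ℕ)}, 𝒜 i),
      ∏ i, f i (e.symm (b, c) i) = (∏ i, f i.1 (b i)) * ∏ i, f i.1 (c i) := by
    intro f b c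
    rw [← Fintype.prod_subtype_mul_prod_subtype (fun i : Fin N => m ≤ (i : ℕ))]
    congr 1
    · exact Finset.prod_congr rfl fun i _ => by simp [e, Equiv.piEquivPiSubtypeProd, i.2]
    · exact Finset.prod_congr rfl fun i _ => by
        rw [Equiv.piEquivPiSubtypeProd_symm_apply, dif_neg i.2]
  have hQ : ∀ b c, Qpart π Q m (e.symm (b, c))
      = ∑ b' : ∀ i : {i : Fin N // m ≤ (i : ℕ)}, 𝒜 i,
        (∏ i, π i.1 (b' i)) * Q (e.symm (b', c)) := by
    intro b c
    refine Finset.sum_congr rfl fun b' _ => ?_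
    congr 2
    funext i
    by_cases h : m ≤ (i : ℕ) <;> simp [e, Equiv.piEquivPiSubtypeProd, h]
  have hmix : ∀ (b : ∀ i : {i : Fin N // m ≤ (i : ℕ)}, 𝒜 i)
      (c : ∀ i : {i : Fin N // ¬ m ≤ (i : ℕ)}, 𝒜 i),
      (∏ i : Fin N, if (i : ℕ) < m then p i (e.symm (b, c) i) else π i (e.symm (b, c) i))
        = (∏ i, π i.1 (b i)) * ∏ i, p i.1 (c i) := by
    intro b c
    rw [hsplit (fun i x => if (i : ℕ) < m then p i x else π i x)]
    congr 1
    · exact Finset.prod_congr rfl fun i _ => if_neg (not_lt.2 i.2)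
    · exact Finset.prod_congr rfl fun i _ => if_pos (not_le.1 i.2)
  rw [← e.symm.sum_comp, ← e.symm.sum_comp, Fintype.sum_prod_type, Fintype.sum_prod_type]
  simp only [hQ, hmix, hsplit]
  calc _ = (∑ b : ∀ i : {i : Fin N // m ≤ (i : ℕ)}, 𝒜 i, ∏ i, p i.1 (b i)) *
        ∑ c : ∀ i : {i : Fin N // ¬ m ≤ (i : ℕ)}, 𝒜 i, (∏ i, p i.1 (c i)) *
          ∑ b' : ∀ i : {i : Fin N // m ≤ (i : ℕ)}, 𝒜 i,
            (∏ i, π i.1 (b' i)) * Q (e.symm (b', c)) := by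
        rw [Finset.sum_mul]
        refine Finset.sum_congr rfl fun b _ => ?_
        rw [Finset.mul_sum]
        exact Finset.sum_congr rfl fun c _ => mul_assoc _ _ _
    _ = _ := by
        rw [sum_pi_prod_eq_one fun i => hp i.1, one_mul, Finset.sum_comm]
        refine Finset.sum_congr rfl fun c _ => ?_
        rw [Finset.mul_sum]
        exact Finset.sum_congr rfl fun b _ => by ring

/-- The sequential surrogates telescope to the change of the expectation of `Q`. -/
theorem sum_sequential_surrogate (π π' : ∀ i, 𝒜 i → ℝ) (hπ : ∀ i, ∑ x, π i x = 1)
    (hπ' : ∀ i, ∑ x, π' i x = 1) (Q : (∀ i, 𝒜 i) → ℝ) :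
    ∑ l : Fin N, ∑ a : ∀ i, 𝒜 i,
        (∏ i : Fin N, if (i : ℕ) ≤ (l : ℕ) then π' i (a i) else π i (a i)) *
          (Qpart π Q ((l : ℕ) + 1) a - Qpart π Q (l : ℕ) a)
      = ∑ a : ∀ i, 𝒜 i, (∏ i, π' i (a i)) * Q a - ∑ a : ∀ i, 𝒜 i, (∏ i, π i (a i)) * Q a := by
  let hybrid : ℕ → ℝ := fun m =>
    ∑ a : ∀ i, 𝒜 i, (∏ i : Fin N, if (i : ℕ) < m then π' i (a i) else π i (a i)) * Q a
  have hstep : ∀ l : Fin N, ∑ a : ∀ i, 𝒜 i,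
        (∏ i : Fin N, if (i : ℕ) ≤ (l : ℕ) then π' i (a i) else π i (a i)) *
          (Qpart π Q ((l : ℕ) + 1) a - Qpart π Q (l : ℕ) a)
      = hybrid ((l : ℕ) + 1) - hybrid l := by
    intro l
    have hsum : ∀ i : Fin N, ∑ x, (if (i : ℕ) ≤ (l : ℕ) then π' i x else π i x) = 1 := by
      intro i
      split_ifs
      exacts [hπ' i, hπ i]
    have h := sum_pi_prod_mul_Qpart π
      (fun i x => if (i : ℕ) ≤ (l : ℕ) then π' i x else π i x) hsum Q
    simp only [mul_sub, Finset.sum_sub_distrib, h, hybrid]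
    congr 1
    · refine Finset.sum_congr rfl fun a _ => congrArg (· * Q a) ?_
      refine Finset.prod_congr rfl fun i _ => ?_
      split_ifs <;> first | rfl | omega
    · refine Finset.sum_congr rfl fun a _ => congrArg (· * Q a) ?_
      refine Finset.prod_congr rfl fun i _ => ?_
      split_ifs <;> first | rfl | omega
  rw [Finset.sum_congr rfl fun l _ => hstep l,
    Fin.sum_univ_eq_sum_range (fun m => hybrid (m + 1) - hybrid m), Finset.sum_range_sub]
  simp [hybrid]

/-- The advantage of a mixture of product policies over `c` splits into the advantages of the
mixing weights and the sequential surrogates of the factors. -/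
theorem sum_mixture_mul_sub {κ : Type*} [Fintype κ] (v : κ → ℝ)
    (π π' : κ → ∀ i, 𝒜 i → ℝ) (hπ : ∀ j i, ∑ x, π j i x = 1) (hπ' : ∀ j i, ∑ x, π' j i x = 1)
    (Q : (∀ i, 𝒜 i) → ℝ) (c : ℝ) :
    ∑ a : ∀ i, 𝒜 i, (∑ j, v j * ∏ i, π' j i (a i)) * (Q a - c)
      = ∑ j, v j * ((∑ a : ∀ i, 𝒜 i, (∏ i, π j i (a i)) * Q a) - c)
        + ∑ l : Fin N, ∑ j, v j * ∑ a : ∀ i, 𝒜 i,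
          (∏ i : Fin N, if (i : ℕ) ≤ (l : ℕ) then π' j i (a i) else π j i (a i)) *
            (Qpart (π j) Q ((l : ℕ) + 1) a - Qpart (π j) Q (l : ℕ) a) := by
  rw [Finset.sum_comm (s := (Finset.univ : Finset (Fin N)))]
  simp only [← Finset.mul_sum, sum_sequential_surrogate _ _ (hπ _) (hπ' _)]
  rw [← Finset.sum_add_distrib]
  simp only [Finset.sum_mul]
  rw [Finset.sum_comm]
  refine Finset.sum_congr rfl fun j _ => ?_
  simp only [mul_sub, Finset.sum_sub_distrib, mul_assoc]
  rw [← Finset.mul_sum, ← Finset.mul_sum, ← Finset.sum_mul, sum_pi_prod_eq_one (hπ' j)]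
  ring

end PartialQ

section MDP

variable {𝒜 : Type*} [Fintype S] [Fintype 𝒜] {P : S → 𝒜 → S → ℝ} {μ : S → 𝒜 → ℝ}
  {r : S → 𝒜 → ℝ} {γ : ℝ} {d₀ : S → ℝ}

theorem dseq_nonneg (hP0 : ∀ s a s', 0 ≤ P s a s') (hμ0 : ∀ s a, 0 ≤ μ s a)
    (hd0 : ∀ s, 0 ≤ d₀ s) (t : ℕ) (s : S) : 0 ≤ dseq P μ d₀ t s := by
  induction t generalizing s with
  | zero => exact hd0 s
  | succ t ih =>
    exact Finset.sum_nonneg fun s' _ => Finset.sum_nonneg fun a _ =>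
      mul_nonneg (mul_nonneg (ih s') (hμ0 s' a)) (hP0 s' a s)

/-- Pushing state-action weights through the transition function preserves integrals. -/
theorem sum_transition_mul (x : S → 𝒜 → ℝ) (f : S → ℝ) :
    ∑ s', (∑ s, ∑ a, x s a * P s a s') * f s' = ∑ s, ∑ a, x s a * ∑ s', P s a s' * f s' := by
  simp only [Finset.sum_mul, Finset.mul_sum, mul_assoc]
  rw [Finset.sum_comm]
  exact Finset.sum_congr rfl fun s _ => Finset.sum_comm

theorem sum_transition (hP1 : ∀ s a, ∑ s', P s a s' = 1) (x : S → 𝒜 → ℝ) :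
    ∑ s', ∑ s, ∑ a, x s a * P s a s' = ∑ s, ∑ a, x s a := by
  simpa [hP1] using sum_transition_mul (P := P) x fun _ => 1

theorem sum_sum_mul_policy (hμ1 : ∀ s, ∑ a, μ s a = 1) (x : S → ℝ) :
    ∑ s, ∑ a, x s * μ s a = ∑ s, x s := by
  simp [← Finset.mul_sum, hμ1]

theorem sum_dseq (hP1 : ∀ s a, ∑ s', P s a s' = 1) (hμ1 : ∀ s, ∑ a, μ s a = 1)
    (hd1 : ∑ s, d₀ s = 1) (t : ℕ) : ∑ s, dseq P μ d₀ t s = 1 := by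
  induction t with
  | zero => exact hd1
  | succ t ih =>
    rw [← ih, ← sum_sum_mul_policy hμ1 (dseq P μ d₀ t)]
    exact sum_transition hP1 fun s a => dseq P μ d₀ t s * μ s a

theorem dseq_linear [DecidableEq S] (t : ℕ) (s : S) :
    dseq P μ d₀ t s = ∑ x, d₀ x * dseq P μ (fun y => if y = x then 1 else 0) t s := by
  induction t generalizing s with
  | zero => simp [dseq]
  | succ t ih =>
    simp only [dseq, Finset.mul_sum]
    symm
    rw [Finset.sum_comm]
    refine Finset.sum_congr rfl fun s' _ => ?_
    rw [Finset.sum_comm]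
    refine Finset.sum_congr rfl fun a _ => ?_
    rw [ih, Finset.sum_mul, Finset.sum_mul]
    exact Finset.sum_congr rfl fun x _ => by ring

theorem summable_discounted_dseq (hγ0 : 0 ≤ γ) (hγ1 : γ < 1) (hP0 : ∀ s a s', 0 ≤ P s a s')
    (hP1 : ∀ s a, ∑ s', P s a s' = 1) (hμ0 : ∀ s a, 0 ≤ μ s a) (hμ1 : ∀ s, ∑ a, μ s a = 1)
    (hd0 : ∀ s, 0 ≤ d₀ s) (hd1 : ∑ s, d₀ s = 1) (s : S) :
    Summable fun t : ℕ => γ ^ t * dseq P μ d₀ t s := by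
  have hnn := dseq_nonneg hP0 hμ0 hd0
  refine Summable.of_nonneg_of_le (fun t => mul_nonneg (pow_nonneg hγ0 t) (hnn t s))
    (fun t => ?_) (summable_geometric_of_lt_one hγ0 hγ1)
  refine mul_le_of_le_one_right (pow_nonneg hγ0 t) ?_
  rw [← sum_dseq hP1 hμ1 hd1 t]
  exact Finset.single_le_sum (f := dseq P μ d₀ t) (fun x _ => hnn t x) (Finset.mem_univ s)

theorem rho_nonneg (hγ0 : 0 ≤ γ) (hP0 : ∀ s a s', 0 ≤ P s a s') (hμ0 : ∀ s a, 0 ≤ μ s a)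
    (hd0 : ∀ s, 0 ≤ d₀ s) (s : S) : 0 ≤ rho P μ d₀ γ s :=
  tsum_nonneg fun t => mul_nonneg (pow_nonneg hγ0 t) (dseq_nonneg hP0 hμ0 hd0 t s)

/-- Integrating against the visitation measure. -/
theorem tsum_discounted_sum_dseq
    (hsum : ∀ s, Summable fun t : ℕ => γ ^ t * dseq P μ d₀ t s) (f : S → ℝ) :
    ∑' t : ℕ, γ ^ t * ∑ s, dseq P μ d₀ t s * f s = ∑ s, rho P μ d₀ γ s * f s := by
  simp only [Finset.mul_sum, ← mul_assoc]
  rw [Summable.tsum_finsetSum fun s _ => (hsum s).mul_right (f s)]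
  exact Finset.sum_congr rfl fun s _ => tsum_mul_right

theorem Jret_eq_sum_rho (hsum : ∀ s, Summable fun t : ℕ => γ ^ t * dseq P μ d₀ t s) :
    Jret P r γ μ d₀ = ∑ s, rho P μ d₀ γ s * ∑ a, μ s a * r s a := by
  rw [← tsum_discounted_sum_dseq hsum]
  simp only [Jret, Finset.mul_sum, mul_assoc]

/-- The balance equation of the visitation measure. -/
theorem rho_balance (hsum : ∀ s, Summable fun t : ℕ => γ ^ t * dseq P μ d₀ t s) (s' : S) :
    rho P μ d₀ γ s' = d₀ s' + γ * ∑ s, ∑ a, rho P μ d₀ γ s * μ s a * P s a s' := by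
  have h := tsum_discounted_sum_dseq hsum fun s => ∑ a, μ s a * P s a s'
  have hstep : ∀ t : ℕ, γ ^ (t + 1) * dseq P μ d₀ (t + 1) s'
      = γ * (γ ^ t * ∑ s, dseq P μ d₀ t s * ∑ a, μ s a * P s a s') := by
    intro t
    simp only [dseq, Finset.mul_sum, mul_assoc, pow_succ']
  rw [rho, (hsum s').tsum_eq_zero_add]
  simp only [hstep]
  rw [tsum_mul_left, h]
  simp only [Finset.mul_sum, mul_assoc, pow_zero, one_mul, dseq]

theorem sum_rho_mul_balance (hsum : ∀ s, Summable fun t : ℕ => γ ^ t * dseq P μ d₀ t s)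
    (f : S → ℝ) :
    ∑ s, rho P μ d₀ γ s * f s = ∑ s, d₀ s * f s
      + γ * ∑ s, ∑ a, rho P μ d₀ γ s * μ s a * ∑ s', P s a s' * f s' := by
  rw [← sum_transition_mul, Finset.mul_sum, ← Finset.sum_add_distrib]
  refine Finset.sum_congr rfl fun s _ => ?_
  rw [rho_balance hsum s]
  ring

theorem dseq_succ_eq_dseq_dseq_one (t : ℕ) :
    dseq P μ d₀ (t + 1) = dseq P μ (dseq P μ d₀ 1) t := by
  induction t with
  | zero => rfl
  | succ t ih =>
    funext s'
    rw [dseq, ih]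
    rfl

theorem Jret_eq_add_Jret_step (hsum : ∀ s, Summable fun t : ℕ => γ ^ t * dseq P μ d₀ t s) :
    Jret P r γ μ d₀ = (∑ s, ∑ a, d₀ s * μ s a * r s a) + γ * Jret P r γ μ (dseq P μ d₀ 1) := by
  have hsummable : Summable fun t : ℕ => γ ^ t * ∑ s, ∑ a, dseq P μ d₀ t s * μ s a * r s a := by
    have h : Summable fun t : ℕ => ∑ s, γ ^ t * dseq P μ d₀ t s * ∑ a, μ s a * r s a :=
      summable_sum fun s _ => (hsum s).mul_right _
    simpa only [Finset.mul_sum, mul_assoc] using h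
  rw [Jret, hsummable.tsum_eq_zero_add, Jret, ← tsum_mul_left]
  congr 1
  · simp [dseq]
  · exact tsum_congr fun t => by rw [dseq_succ_eq_dseq_dseq_one, pow_succ', mul_assoc]

/-- Policies that are uniformly close have close visitation measures. -/
theorem sum_abs_rho_sub_le {μ' : S → 𝒜 → ℝ} {β : ℝ} (hγ0 : 0 ≤ γ)
    (hP0 : ∀ s a s', 0 ≤ P s a s') (hP1 : ∀ s a, ∑ s', P s a s' = 1)
    (hμ0 : ∀ s a, 0 ≤ μ s a) (hμ0' : ∀ s a, 0 ≤ μ' s a) (hμ1' : ∀ s, ∑ a, μ' s a = 1)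
    (hd0 : ∀ s, 0 ≤ d₀ s)
    (hsum : ∀ s, Summable fun t : ℕ => γ ^ t * dseq P μ d₀ t s)
    (hsum' : ∀ s, Summable fun t : ℕ => γ ^ t * dseq P μ' d₀ t s)
    (hβ : ∀ s, ∑ a, |μ' s a - μ s a| ≤ β) :
    (1 - γ) * ∑ s, |rho P μ' d₀ γ s - rho P μ d₀ γ s| ≤ γ * β * ∑ s, rho P μ d₀ γ s := by
  have hρ := rho_nonneg hγ0 hP0 hμ0 hd0
  set ρ := rho P μ d₀ γ with hρdef
  set ρ' := rho P μ' d₀ γ with hρdef'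
  have hflow : ∀ s', ρ' s' - ρ s' = γ * ∑ s, ∑ a, (ρ' s * μ' s a - ρ s * μ s a) * P s a s' := by
    intro s'
    have h := rho_balance hsum s'
    have h' := rho_balance hsum' s'
    rw [← hρdef] at h
    rw [← hρdef'] at h'
    rw [h, h']
    simp only [sub_mul, Finset.sum_sub_distrib]
    ring
  have hpoint : ∀ s a, |ρ' s * μ' s a - ρ s * μ s a|
      ≤ |ρ' s - ρ s| * μ' s a + ρ s * |μ' s a - μ s a| := by
    intro s a
    calc |ρ' s * μ' s a - ρ s * μ s a|
        = |(ρ' s - ρ s) * μ' s a + ρ s * (μ' s a - μ s a)| := by ring_nf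
      _ ≤ _ := by
          refine (abs_add_le _ _).trans_eq ?_
          rw [abs_mul, abs_mul, abs_of_nonneg (hμ0' s a), abs_of_nonneg (hρ s)]
  have hmain : ∑ s', |ρ' s' - ρ s'| ≤ γ * (∑ s, |ρ' s - ρ s| + (∑ s, ρ s) * β) := by
    calc ∑ s', |ρ' s' - ρ s'|
        ≤ ∑ s', γ * ∑ s, ∑ a, |ρ' s * μ' s a - ρ s * μ s a| * P s a s' := by
          refine Finset.sum_le_sum fun s' _ => ?_
          rw [hflow, abs_mul, abs_of_nonneg hγ0]
          refine mul_le_mul_of_nonneg_left ?_ hγ0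
          refine (Finset.abs_sum_le_sum_abs _ _).trans (Finset.sum_le_sum fun s _ => ?_)
          refine (Finset.abs_sum_le_sum_abs _ _).trans_eq (Finset.sum_congr rfl fun a _ => ?_)
          rw [abs_mul, abs_of_nonneg (hP0 s a s')]
      _ = γ * ∑ s, ∑ a, |ρ' s * μ' s a - ρ s * μ s a| := by
          rw [← Finset.mul_sum, sum_transition hP1]
      _ ≤ γ * ∑ s, (|ρ' s - ρ s| + ρ s * β) := by
          refine mul_le_mul_of_nonneg_left (Finset.sum_le_sum fun s _ => ?_) hγ0
          refine (Finset.sum_le_sum fun a _ => hpoint s a).trans ?_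
          rw [Finset.sum_add_distrib, ← Finset.mul_sum, ← Finset.mul_sum, hμ1', mul_one]
          exact add_le_add_right (mul_le_mul_of_nonneg_left (hβ s) (hρ s)) _
      _ = _ := by rw [Finset.sum_add_distrib, Finset.sum_mul]
  linarith

variable [DecidableEq S]

theorem Jret_eq_sum_Vfun
    (hsum : ∀ x s, Summable fun t : ℕ =>
      γ ^ t * dseq P μ (fun y => if y = x then 1 else 0) t s) :
    Jret P r γ μ d₀ = ∑ x, d₀ x * Vfun P r γ μ x := by
  have hlin : ∀ t s, γ ^ t * dseq P μ d₀ t s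
      = ∑ x, d₀ x * (γ ^ t * dseq P μ (fun y => if y = x then 1 else 0) t s) := by
    intro t s
    rw [dseq_linear, Finset.mul_sum]
    exact Finset.sum_congr rfl fun x _ => by ring
  have hrho : ∀ s, rho P μ d₀ γ s
      = ∑ x, d₀ x * rho P μ (fun y => if y = x then 1 else 0) γ s := by
    intro s
    simp only [rho, hlin, ← tsum_mul_left]
    exact Summable.tsum_finsetSum fun x _ => (hsum x s).mul_left (d₀ x)
  have hd : ∀ s, Summable fun t : ℕ => γ ^ t * dseq P μ d₀ t s := by
    intro s
    simp only [hlin]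
    exact summable_sum fun x _ => (hsum x s).mul_left (d₀ x)
  simp only [Vfun, Jret_eq_sum_rho hd, Jret_eq_sum_rho (hsum _), hrho]
  simp only [Finset.sum_mul]
  rw [Finset.sum_comm]
  refine Finset.sum_congr rfl fun x _ => ?_
  rw [Finset.mul_sum]
  exact Finset.sum_congr rfl fun s _ => mul_assoc _ _ _

/-- The Bellman equation. -/
theorem Vfun_eq_sum_mul_Qfun
    (hsum : ∀ x s, Summable fun t : ℕ =>
      γ ^ t * dseq P μ (fun y => if y = x then 1 else 0) t s) (s : S) :
    Vfun P r γ μ s = ∑ a, μ s a * Qfun P r γ μ s a := by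
  rw [Vfun, Jret_eq_add_Jret_step (hsum s), Jret_eq_sum_Vfun hsum]
  have h := sum_transition_mul (P := P) (fun x a => (if x = s then (1 : ℝ) else 0) * μ x a)
    (Vfun P r γ μ)
  simp only [dseq, h, Qfun]
  simp [mul_add, Finset.sum_add_distrib, Finset.mul_sum, mul_left_comm]

/-- The performance difference lemma. -/
theorem Jret_sub_Jret {μ' : S → 𝒜 → ℝ} (hμ1' : ∀ s, ∑ a, μ' s a = 1)
    (hsum : ∀ x s, Summable fun t : ℕ =>
      γ ^ t * dseq P μ (fun y => if y = x then 1 else 0) t s)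
    (hsum' : ∀ s, Summable fun t : ℕ => γ ^ t * dseq P μ' d₀ t s) :
    Jret P r γ μ' d₀ - Jret P r γ μ d₀
      = ∑ s, rho P μ' d₀ γ s * ∑ a, μ' s a * Adv P r γ μ s a := by
  have hbal := sum_rho_mul_balance hsum' (Vfun P r γ μ)
  have hadv : ∀ s, ∑ a, μ' s a * Adv P r γ μ s a = (∑ a, μ' s a * r s a)
      + γ * (∑ a, μ' s a * ∑ s', P s a s' * Vfun P r γ μ s') - Vfun P r γ μ s := by
    intro s
    simp only [Adv, Qfun, mul_sub, mul_add, Finset.sum_sub_distrib, Finset.sum_add_distrib]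
    rw [← Finset.sum_mul, hμ1', one_mul, Finset.mul_sum]
    simp only [mul_left_comm]
  rw [Jret_eq_sum_rho hsum', Jret_eq_sum_Vfun hsum]
  simp only [hadv, mul_sub, mul_add, Finset.sum_sub_distrib, Finset.sum_add_distrib]
  rw [hbal]
  simp only [Finset.mul_sum, mul_assoc, mul_left_comm]
  ring

theorem sum_mul_Adv_self (hμ1 : ∀ s, ∑ a, μ s a = 1)
    (hsum : ∀ x s, Summable fun t : ℕ =>
      γ ^ t * dseq P μ (fun y => if y = x then 1 else 0) t s) (s : S) :
    ∑ a, μ s a * Adv P r γ μ s a = 0 := by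
  simp only [Adv, mul_sub, Finset.sum_sub_distrib]
  rw [← Finset.sum_mul, hμ1, one_mul, ← Vfun_eq_sum_mul_Qfun hsum, sub_self]

/-- The trust-region lower bound on the improvement of the return. -/
theorem surrogate_sub_penalty_le_Jret_sub {μ' : S → 𝒜 → ℝ} {ε κ : ℝ} (hγ0 : 0 ≤ γ)
    (hγ1 : γ < 1) (hP0 : ∀ s a s', 0 ≤ P s a s') (hP1 : ∀ s a, ∑ s', P s a s' = 1)
    (hμ0 : ∀ s a, 0 < μ s a) (hμ1 : ∀ s, ∑ a, μ s a = 1)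
    (hμ0' : ∀ s a, 0 < μ' s a) (hμ1' : ∀ s, ∑ a, μ' s a = 1)
    (hd0 : ∀ s, 0 ≤ d₀ s) (hd1 : ∑ s, d₀ s = 1)
    (hε0 : 0 ≤ ε) (hε : ∀ s a, |Adv P r γ μ s a| ≤ ε)
    (hκ0 : 0 ≤ κ) (hκ : ∀ s, KL (μ s) (μ' s) ≤ κ) :
    (∑ s, rho P μ d₀ γ s * ∑ a, μ' s a * Adv P r γ μ s a)
        - 4 * γ * ε / (1 - γ) ^ 2 * (∑ s, rho P μ d₀ γ s) * κ
      ≤ Jret P r γ μ' d₀ - Jret P r γ μ d₀ := by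
  have hμ := fun s a => (hμ0 s a).le
  have hμ' := fun s a => (hμ0' s a).le
  have hsum := summable_discounted_dseq hγ0 hγ1 hP0 hP1 hμ hμ1 hd0 hd1
  have hsum' := summable_discounted_dseq hγ0 hγ1 hP0 hP1 hμ' hμ1' hd0 hd1
  have hdirac : ∀ x s, Summable fun t : ℕ =>
      γ ^ t * dseq P μ (fun y => if y = x then 1 else 0) t s := fun x =>
    summable_discounted_dseq hγ0 hγ1 hP0 hP1 hμ hμ1
      (fun s => by split_ifs <;> norm_num) (by simp)
  have hβ : ∀ s, ∑ a, |μ' s a - μ s a| ≤ 2 * √κ := by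
    intro s
    refine abs_le_of_sq_le_sq' ?_ (by positivity) |>.2
    rw [mul_pow, Real.sq_sqrt hκ0]
    have := sq_sum_abs_sub_le_four_mul_KL (hμ0 s) (hμ0' s) (hμ1 s) (hμ1' s)
    linarith [hκ s]
  have hρdist := sum_abs_rho_sub_le hγ0 hP0 hP1 hμ hμ' hμ1' hd0 hsum hsum' hβ
  have hadv : ∀ s, |∑ a, μ' s a * Adv P r γ μ s a| ≤ 2 * √κ * ε := by
    intro s
    have h : ∑ a, μ' s a * Adv P r γ μ s a = ∑ a, (μ' s a - μ s a) * Adv P r γ μ s a := by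
      simp only [sub_mul, Finset.sum_sub_distrib, sum_mul_Adv_self hμ1 hdirac, sub_zero]
    rw [h]
    calc |∑ a, (μ' s a - μ s a) * Adv P r γ μ s a|
        ≤ ∑ a, |μ' s a - μ s a| * ε := by
          refine (Finset.abs_sum_le_sum_abs _ _).trans (Finset.sum_le_sum fun a _ => ?_)
          rw [abs_mul]
          exact mul_le_mul_of_nonneg_left (hε s a) (abs_nonneg _)
      _ ≤ 2 * √κ * ε := by
          rw [← Finset.sum_mul]
          exact mul_le_mul_of_nonneg_right (hβ s) hε0
  have hR : 0 ≤ ∑ s, rho P μ d₀ γ s :=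
    Finset.sum_nonneg fun s _ => rho_nonneg hγ0 hP0 hμ hd0 s
  rw [Jret_sub_Jret hμ1' hdirac hsum']
  set R := ∑ s, rho P μ d₀ γ s
  set D := ∑ s, |rho P μ' d₀ γ s - rho P μ d₀ γ s|
  have hchange : (∑ s, rho P μ d₀ γ s * ∑ a, μ' s a * Adv P r γ μ s a)
      - ∑ s, rho P μ' d₀ γ s * ∑ a, μ' s a * Adv P r γ μ s a ≤ D * (2 * √κ * ε) := by
    rw [← Finset.sum_sub_distrib, Finset.sum_mul]
    refine Finset.sum_le_sum fun s _ => ?_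
    rw [← sub_mul]
    refine (le_abs_self _).trans ?_
    rw [abs_mul, abs_sub_comm]
    exact mul_le_mul_of_nonneg_left (hadv s) (abs_nonneg _)
  have hγ : 0 < 1 - γ := by linarith
  have hpenalty : D * (2 * √κ * ε) ≤ 4 * γ * ε / (1 - γ) ^ 2 * R * κ := by
    have hnum : 0 ≤ 4 * γ * ε * R * κ := by positivity
    calc D * (2 * √κ * ε) ≤ γ * (2 * √κ) * R / (1 - γ) * (2 * √κ * ε) := by
          refine mul_le_mul_of_nonneg_right ?_ (by positivity)
          rw [le_div_iff₀ hγ]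
          linarith
      _ = 4 * γ * ε * R * √κ ^ 2 / (1 - γ) := by ring
      _ = 4 * γ * ε * R * κ / (1 - γ) := by rw [Real.sq_sqrt hκ0]
      _ ≤ 4 * γ * ε * R * κ / (1 - γ) ^ 2 :=
          div_le_div_of_nonneg_left hnum (by positivity) (by nlinarith)
      _ = _ := by ring
  linarith

end MDP

/-- (Guaranteed monotonic joint policy optimization.)  If the conductor's
update satisfies the penalized improvement condition (H1) and each agent's
sequential surrogate update satisfies the penalized improvement condition
(H2), then the return of the induced joint policy does not decrease:
`J(μ_{k+1}) ≥ J(μ_k)`.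

Here the sequential surrogate `L^{l+1}_k(π^{1:l}_{k+1}, π^{l+1}_{k+1} | s, j)`
is realized as an expectation over full action tuples: coordinates `r ≤ l` are
weighted by the new policies `π^r_{k+1}(j,s,·)`, and the remaining coordinates
(on which the individual advantage
`A^{l+1}_k = Q^{1:l+1}_k − Q^{1:l}_k` does not depend) are marginalized out
under the old policies `π^r_k(j,s,·)`. -/
theorem guaranteed_monotonic_improvement
    [Fintype S] [Nonempty S] [DecidableEq S]
    (N : ℕ) (hN : 1 ≤ N) (𝒜i : Fin N → Type*)
    [∀ i, Fintype (𝒜i i)] [∀ i, Nonempty (𝒜i i)]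
    (P : S → (∀ i, 𝒜i i) → S → ℝ) (r : S → (∀ i, 𝒜i i) → ℝ) (γ : ℝ)
    (hγ0 : 0 ≤ γ) (hγ1 : γ < 1)
    (hP0 : ∀ s a s', 0 ≤ P s a s') (hP1 : ∀ s a, ∑ s', P s a s' = 1)
    (d₀ : S → ℝ) (hd0 : ∀ s, 0 ≤ d₀ s) (hd1 : ∑ s, d₀ s = 1)
    (K : ℕ) (hK : 1 ≤ K)
    (wk wk1 : S → Fin K → ℝ)
    (πk πk1 : ∀ i : Fin N, Fin K → S → 𝒜i i → ℝ)
    (hwk : ∀ s j, 0 < wk s j) (hwk1 : ∀ s, ∑ j, wk s j = 1)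
    (hwk1' : ∀ s j, 0 < wk1 s j) (hwk1'' : ∀ s, ∑ j, wk1 s j = 1)
    (hπk : ∀ i j s x, 0 < πk i j s x) (hπksum : ∀ i j s, ∑ x, πk i j s x = 1)
    (hπk1 : ∀ i j s x, 0 < πk1 i j s x) (hπk1sum : ∀ i j s, ∑ x, πk1 i j s x = 1)
    (μk μk1 : S → (∀ i, 𝒜i i) → ℝ)
    (hμk : μk = fun s a => ∑ j, wk s j * ∏ i, πk i j s (a i))
    (hμk1 : μk1 = fun s a => ∑ j, wk1 s j * ∏ i, πk1 i j s (a i))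
    (C : ℝ)
    (hC : C = 4 * γ * (Finset.univ.sup' Finset.univ_nonempty
        fun p : S × (∀ i, 𝒜i i) => |Adv P r γ μk p.1 p.2|) / (1 - γ) ^ 2)
    -- (H1): penalized improvement condition for the conductor update
    (H1 : ∑ s, rho P μk d₀ γ s *
          ∑ j, wk1 s j *
            ((∑ a : ∀ i, 𝒜i i, (∏ i, πk i j s (a i)) * Qfun P r γ μk s a)
              - Vfun P r γ μk s)
        - C * (∑ s, rho P μk d₀ γ s) *
            (Finset.univ.sup' Finset.univ_nonempty
              fun s' => KL (wk s') (wk1 s')) ≥ 0)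
    -- (H2): penalized improvement condition for each agent's sequential update
    (H2 : ∀ l : Fin N,
        ∑ s, rho P μk d₀ γ s *
          ∑ j,
            (wk1 s j *
              (∑ a : ∀ i, 𝒜i i,
                (∏ i : Fin N, if (i : ℕ) ≤ (l : ℕ) then πk1 i j s (a i)
                  else πk i j s (a i)) *
                  (Qpart (fun i => πk i j s) (fun b => Qfun P r γ μk s b)
                      ((l : ℕ) + 1) a
                    - Qpart (fun i => πk i j s) (fun b => Qfun P r γ μk s b)
                        (l : ℕ) a))
              - C * (Finset.univ.sup' Finset.univ_nonempty
                  fun s' => wk s' j * KL (πk l j s') (πk1 l j s'))) ≥ 0) :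
    Jret P r γ μk1 d₀ ≥ Jret P r γ μk d₀ := by
  set ε := Finset.univ.sup' Finset.univ_nonempty
    fun p : S × (∀ i, 𝒜i i) => |Adv P r γ μk p.1 p.2|
  have : Nonempty (Fin K) := ⟨⟨0, hK⟩⟩
  have hε : ∀ s a, |Adv P r γ μk s a| ≤ ε := fun s a =>
    Finset.le_sup' (fun p : S × (∀ i, 𝒜i i) => |Adv P r γ μk p.1 p.2|) (Finset.mem_univ (s, a))
  have hε0 : 0 ≤ ε := (abs_nonneg _).trans (hε (Classical.arbitrary S) (Classical.arbitrary _))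
  have hμpos : ∀ s a, 0 < μk s a := fun s a => by
    rw [hμk]
    exact Finset.sum_pos (fun j _ => mul_pos (hwk s j) (Finset.prod_pos fun i _ => hπk i j s _))
      Finset.univ_nonempty
  have hμpos' : ∀ s a, 0 < μk1 s a := fun s a => by
    rw [hμk1]
    exact Finset.sum_pos
      (fun j _ => mul_pos (hwk1' s j) (Finset.prod_pos fun i _ => hπk1 i j s _))
      Finset.univ_nonempty
  have hμsum : ∀ s, ∑ a, μk s a = 1 := fun s => by
    rw [hμk]
    exact sum_mixture_eq_one (hwk1 s) fun j i => hπksum i j s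
  have hμsum' : ∀ s, ∑ a, μk1 s a = 1 := fun s => by
    rw [hμk1]
    exact sum_mixture_eq_one (hwk1'' s) fun j i => hπk1sum i j s
  set M := Finset.univ.sup' Finset.univ_nonempty fun s' => KL (wk s') (wk1 s')
  let m : Fin N → Fin K → ℝ := fun l j => Finset.univ.sup' Finset.univ_nonempty
    fun s' => wk s' j * KL (πk l j s') (πk1 l j s')
  have hκ : ∀ s, KL (μk s) (μk1 s) ≤ M + ∑ l, ∑ j, m l j := by
    intro s
    rw [hμk, hμk1]
    refine (KL_mixture_le (p := fun j i => πk i j s) (q := fun j i => πk1 i j s) (hwk s)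
      (hwk1' s) (fun j i => hπk i j s) (fun j i => hπk1 i j s)
      (fun j i => hπksum i j s)).trans ?_
    refine add_le_add
      (Finset.le_sup' (fun s' => KL (wk s') (wk1 s')) (Finset.mem_univ s)) ?_
    exact Finset.sum_le_sum fun l _ => Finset.sum_le_sum fun j _ =>
      Finset.le_sup' (fun s' => wk s' j * KL (πk l j s') (πk1 l j s')) (Finset.mem_univ s)
  have hκ0 : 0 ≤ M + ∑ l, ∑ j, m l j := by
    have s := Classical.arbitrary S
    have h := sq_sum_abs_sub_le_four_mul_KL (hμpos s) (hμpos' s) (hμsum s) (hμsum' s)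
    linarith [hκ s, sq_nonneg (∑ a, |μk1 s a - μk s a|)]
  have hbound := surrogate_sub_penalty_le_Jret_sub (r := r) hγ0 hγ1 hP0 hP1 hμpos hμsum hμpos'
    hμsum' hd0 hd1 hε0 hε hκ0 hκ
  rw [← hC] at hbound
  let surrogate : Fin N → S → Fin K → ℝ := fun l s j => ∑ a : ∀ i, 𝒜i i,
    (∏ i : Fin N, if (i : ℕ) ≤ (l : ℕ) then πk1 i j s (a i) else πk i j s (a i)) *
      (Qpart (fun i => πk i j s) (fun b => Qfun P r γ μk s b) ((l : ℕ) + 1) a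
        - Qpart (fun i => πk i j s) (fun b => Qfun P r γ μk s b) (l : ℕ) a)
  have hadv : ∀ s, ∑ a, μk1 s a * Adv P r γ μk s a
      = ∑ j, wk1 s j * ((∑ a : ∀ i, 𝒜i i, (∏ i, πk i j s (a i)) * Qfun P r γ μk s a)
          - Vfun P r γ μk s) + ∑ l, ∑ j, wk1 s j * surrogate l s j := by
    intro s
    rw [hμk1]
    exact sum_mixture_mul_sub (wk1 s) (fun j i => πk i j s) (fun j i => πk1 i j s)
      (fun j i => hπksum i j s) (fun j i => hπk1sum i j s) (Qfun P r γ μk s) (Vfun P r γ μk s)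
  have hagents : C * (∑ s, rho P μk d₀ γ s) * ∑ l, ∑ j, m l j
      ≤ ∑ s, rho P μk d₀ γ s * ∑ l, ∑ j, wk1 s j * surrogate l s j := by
    have hagent : ∀ l, C * (∑ s, rho P μk d₀ γ s) * ∑ j, m l j
        ≤ ∑ s, rho P μk d₀ γ s * ∑ j, wk1 s j * surrogate l s j := by
      intro l
      have h : 0 ≤ ∑ s, rho P μk d₀ γ s * ∑ j, (wk1 s j * surrogate l s j - C * m l j) := H2 l
      simp only [Finset.sum_sub_distrib, mul_sub, ← Finset.mul_sum, ← Finset.sum_mul] at h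
      linarith
    rw [Finset.mul_sum]
    refine (Finset.sum_le_sum fun l _ => hagent l).trans_eq ?_
    rw [Finset.sum_comm]
    simp only [Finset.mul_sum]
  simp only [hadv, mul_add, Finset.sum_add_distrib] at hbound
  linarith

end
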